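/- Let N be a high-level Petri net in the class Nf, let ≺ be an adequate order on the finite configurations of its symbolic unfolding Υ, and let Fin be the prefix of Υ consisting of all events e such that the cone [e] contains no cut-off event of Υ other than possibly e itself, together with all conditions in B0 and in the postsets of these events. Then Fin is finite; in particular, every event e of Fin satisfies depth(e) ≤ |R(N)| + 1, where depth(e) is the length of the longest chain of events e1 < e2 < … < e ending in e. -/

import Mathlib

/-
Core formalization of high-level Petri nets, symbolic unfoldings,
branching processes, configurations, adequate orders, cut-off events,
expansions and constraints, following Würdemann–Chatain–Haar–Panneke,
"Taking Complete Finite Prefixes To High Level, Symbolically".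
-/

noncomputable section
open scoped Classical

/-- A high-level Petri net over a set `Color` of colors and a set `Var` of variables:
places, transitions, a flow function (given by the multisets of `(place, variable)`
pairs on the input resp. output arcs of each transition), a guard for each transition
(a predicate on the assignments of colors to variables), and a set of initial markings. -/
structure HLNet (Color : Type) (Var : Type) : Type 1 where
  Place : Type
  Trans : Type
  preFlow : Trans → Multiset (Place × Var)
  postFlow : Trans → Multiset (Place × Var)
  guard : Trans → (Var → Color) → Prop
  init : Set (Multiset (Place × Color))

namespace HLNet

variable {Color Var : Type}

/-- A marking: a multiset over `Place × Color`. -/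
abbrev Marking (N : HLNet Color Var) : Type := Multiset (N.Place × Color)

/-- Well-formedness: the set of initial markings is nonempty, and all initial markings
mark the same places with the same numbers of colors. -/
def WellFormed (N : HLNet Color Var) : Prop :=
  N.init.Nonempty ∧
    ∀ M ∈ N.init, ∀ M' ∈ N.init, Multiset.map Prod.fst M = Multiset.map Prod.fst M'

/-- The net is finite: finitely many places and transitions
(the support of the flow function is then automatically finite). -/
def NetFinite (N : HLNet Color Var) : Prop := Finite N.Place ∧ Finite N.Trans

/-- The guards are written in a decidable theory (stand-in: each guard is a
decidable predicate on modes). -/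
def DecidableGuards (N : HLNet Color Var) : Prop :=
  ∀ t σ, Nonempty (Decidable (N.guard t σ))

/-- `•(t,σ)`, the multiset of colored tokens consumed by transition `t` fired in mode `σ`. -/
def preMark (N : HLNet Color Var) (t : N.Trans) (σ : Var → Color) : N.Marking :=
  (N.preFlow t).map fun pv => (pv.1, σ pv.2)

/-- `(t,σ)•`, the multiset of colored tokens produced by transition `t` fired in mode `σ`. -/
def postMark (N : HLNet Color Var) (t : N.Trans) (σ : Var → Color) : N.Marking :=
  (N.postFlow t).map fun pv => (pv.1, σ pv.2)

/-- `M[t,σ⟩`: transition `t` can fire in mode `σ` from marking `M`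
(`σ` is a mode of `t`, i.e. the guard holds, and `•(t,σ) ≤ M`). -/
def fires (N : HLNet Color Var) (M : N.Marking) (t : N.Trans) (σ : Var → Color) : Prop :=
  N.guard t σ ∧ N.preMark t σ ≤ M

/-- `M[t,σ⟩M'`: firing `t` in mode `σ` from `M` yields `M'`. -/
def firesTo (N : HLNet Color Var) (M : N.Marking) (t : N.Trans) (σ : Var → Color)
    (M' : N.Marking) : Prop :=
  N.fires M t σ ∧ M' = (M - N.preMark t σ) + N.postMark t σ

/-- `R(N)`: the markings reachable from some initial marking by finitely many firings. -/
inductive Reach (N : HLNet Color Var) : N.Marking → Prop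
  | init {M : N.Marking} : M ∈ N.init → Reach N M
  | step {M : N.Marking} {t : N.Trans} {σ : Var → Color} {M' : N.Marking} :
      Reach N M → N.firesTo M t σ M' → Reach N M'

/-- The markings reachable in exactly `n` firings. -/
def ReachSteps (N : HLNet Color Var) : ℕ → N.Marking → Prop
  | 0, M => M ∈ N.init
  | n + 1, M' => ∃ M t σ, ReachSteps N n M ∧ N.firesTo M t σ M'

/-- Every reachable marking is reachable by firing at most `n` transitions. -/
def BoundedReach (N : HLNet Color Var) (n : ℕ) : Prop :=
  ∀ M, N.Reach M → ∃ k ≤ n, N.ReachSteps k M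

/-- Safety: in every reachable marking every place holds at most one color. -/
def Safe (N : HLNet Color Var) : Prop :=
  ∀ M, N.Reach M → ∀ p : N.Place, (M.filter fun pc => pc.1 = p).card ≤ 1

/-- Nodes of the net: places and transitions. -/
abbrev Node (N : HLNet Color Var) : Type := N.Place ⊕ N.Trans

/-- The arc relation `x → y` between nodes. -/
def arc (N : HLNet Color Var) : N.Node → N.Node → Prop
  | Sum.inl b, Sum.inr t => ∃ v, (b, v) ∈ N.preFlow t
  | Sum.inr t, Sum.inl b => ∃ v, (b, v) ∈ N.postFlow t
  | Sum.inl _, Sum.inl _ => False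
  | Sum.inr _, Sum.inr _ => False

/-- The causality relation `<` (irreflexive transitive closure of the arc relation). -/
def clt (N : HLNet Color Var) : N.Node → N.Node → Prop := Relation.TransGen N.arc

/-- The causality relation `≤` (reflexive transitive closure of the arc relation). -/
def cle (N : HLNet Color Var) : N.Node → N.Node → Prop := Relation.ReflTransGen N.arc

/-- `<` on transitions/events. -/
def evLT (N : HLNet Color Var) (e e' : N.Trans) : Prop := N.clt (Sum.inr e) (Sum.inr e')

/-- `≤` on transitions/events. -/
def evLE (N : HLNet Color Var) (e e' : N.Trans) : Prop := N.cle (Sum.inr e) (Sum.inr e')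

/-- Structural conflict `x ♯ y`: distinct transitions sharing an input place
causally precede `x` and `y` respectively. -/
def SConflict (N : HLNet Color Var) (x y : N.Node) : Prop :=
  ∃ (b : N.Place) (t1 t2 : N.Trans), t1 ≠ t2 ∧
    (∃ v, (b, v) ∈ N.preFlow t1) ∧ (∃ v, (b, v) ∈ N.preFlow t2) ∧
    N.cle (Sum.inr t1) x ∧ N.cle (Sum.inr t2) y

/-- Ordinariness: at most one arc connects any two nodes. -/
def Ordinary (N : HLNet Color Var) : Prop :=
  (∀ (t : N.Trans) (b : N.Place), ((N.preFlow t).filter fun pv => pv.1 = b).card ≤ 1) ∧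
  (∀ (t : N.Trans) (b : N.Place), ((N.postFlow t).filter fun pv => pv.1 = b).card ≤ 1)

/-- A high-level occurrence net: an ordinary well-formed high-level Petri net
(places = conditions, transitions = events) such that no event is in structural
self-conflict, no node is its own causal predecessor, causality is well-founded,
and each condition either has no incoming arc and is marked with exactly one color
in all initial cuts, or has a unique incoming arc and is unmarked in all initial cuts. -/
def IsOccNet (O : HLNet Color Var) : Prop :=
  O.WellFormed ∧ O.Ordinary ∧
  (∀ e : O.Trans, ¬ O.SConflict (Sum.inr e) (Sum.inr e)) ∧
  (∀ x : O.Node, ¬ O.clt x x) ∧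
  WellFounded O.clt ∧
  (∀ b : O.Place,
    ((∀ (e : O.Trans) (v : Var), (b, v) ∉ O.postFlow e) ∧
      ∀ K ∈ O.init, (K.filter fun bc => bc.1 = b).card = 1) ∨
    ((∃ (e : O.Trans) (v : Var), (b, v) ∈ O.postFlow e ∧
        ∀ (e' : O.Trans) (v' : Var), (b, v') ∈ O.postFlow e' → e' = e ∧ v' = v) ∧
      ∀ K ∈ O.init, (K.filter fun bc => bc.1 = b).card = 0))

/-- `•b = (e(b), v(b))`: the unique input event and arc-variable of a condition,
or `none` for the `⊥`-conditions (the conditions marked in all initial cuts). -/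
def condPre (O : HLNet Color Var) (b : O.Place) : Option (O.Trans × Var) :=
  if h : ∃ ev : O.Trans × Var, (b, ev.2) ∈ O.postFlow ev.1 then some h.choose else none

/-- An assignment of colors to the indexed variables: the variables `v_e` for events `e`
(`Sum.inl (e, v)`), and the variables `v^b_⊥` for conditions `b` (`Sum.inr b`). -/
abbrev Assign (O : HLNet Color Var) : Type := ((O.Trans × Var) ⊕ O.Place) → Color

/-- The color placed on condition `b` under assignment `ι`:
the value of `v(b)_{e(b)}`, resp. `v^b_⊥`. -/
def valOf (O : HLNet Color Var) (ι : O.Assign) (b : O.Place) : Color :=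
  match O.condPre b with
  | none => ι (Sum.inr b)
  | some ev => ι (Sum.inl ev)

/-- `pred(⊥)`: `ι` chooses one of the initial cuts. -/
def predBot (O : HLNet Color Var) (ι : O.Assign) : Prop :=
  ∃ K ∈ O.init, ∀ (b : O.Place) (c : Color), (b, c) ∈ K → ι (Sum.inr b) = c

/-- `loc(e)`: the local predicate of an event. -/
def locPred (O : HLNet Color Var) (e : O.Trans) (ι : O.Assign) : Prop :=
  O.guard e (fun v => ι (Sum.inl (e, v))) ∧
  ∀ bv ∈ O.preFlow e, ι (Sum.inl (e, bv.2)) = O.valOf ι bv.1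

/-- `pred(e) = pred(⊥) ∧ ⋀_{e' ≤ e} loc(e')`. -/
def pred (O : HLNet Color Var) (e : O.Trans) (ι : O.Assign) : Prop :=
  O.predBot ι ∧ ∀ e', O.evLE e' e → O.locPred e' ι

/-- `pred(e(b))` for a condition `b` (which is `pred(⊥)` for `⊥`-conditions). -/
def condPred (O : HLNet Color Var) (b : O.Place) (ι : O.Assign) : Prop :=
  match O.condPre b with
  | none => O.predBot ι
  | some ev => O.pred ev.1 ι

/-- An instantiation of a set `C` of events: an assignment satisfying `pred(e)` for
every `e ∈ C ∪ {⊥}`. -/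
def IsInst (O : HLNet Color Var) (C : Set O.Trans) (ι : O.Assign) : Prop :=
  O.predBot ι ∧ ∀ e ∈ C, O.pred e ι

/-- A configuration: a causally closed set of events free of structural conflict
and of color conflict. -/
def IsConfig (O : HLNet Color Var) (C : Set O.Trans) : Prop :=
  (∀ e ∈ C, ∀ e', O.evLE e' e → e' ∈ C) ∧
  (∀ e ∈ C, ∀ e' ∈ C, ¬ O.SConflict (Sum.inr e) (Sum.inr e')) ∧
  ∃ ι, O.IsInst C ι

/-- A finite configuration. -/
def FinCfg (O : HLNet Color Var) (C : Set O.Trans) : Prop := O.IsConfig C ∧ C.Finite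

/-- The cone configuration `[e] = {e' : e' ≤ e}` of an event. -/
def cone (O : HLNet Color Var) (e : O.Trans) : Set O.Trans := {e' | O.evLE e' e}

/-- `B0`: the conditions marked in all initial cuts (those with `•b = (⊥, v^b)`). -/
def B0 (O : HLNet Color Var) : Set O.Place := {b | O.condPre b = none}

/-- `C→`: the conditions in the postsets of the events of `C`. -/
def postConds (O : HLNet Color Var) (C : Set O.Trans) : Set O.Place :=
  {b | ∃ e ∈ C, ∃ v, (b, v) ∈ O.postFlow e}

/-- `→C`: the conditions in the presets of the events of `C`. -/
def preConds (O : HLNet Color Var) (C : Set O.Trans) : Set O.Place :=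
  {b | ∃ e ∈ C, ∃ v, (b, v) ∈ O.preFlow e}

/-- `Cut(C) = (B0 ∪ C→) \ →C`. -/
def cut (O : HLNet Color Var) (C : Set O.Trans) : Set O.Place :=
  (O.B0 ∪ O.postConds C) \ O.preConds C

/-- `Cut(C, ι)` as a marking of the occurrence net (requires `Cut(C)` to be finite). -/
def cutMark (O : HLNet Color Var) {C : Set O.Trans} (hfin : (O.cut C).Finite)
    (ι : O.Assign) : O.Marking :=
  hfin.toFinset.val.map fun b => (b, O.valOf ι b)

/-- `Cut(C, ι) = {(b, ι(v(b)_{e(b)})) : b ∈ Cut(C)}` as a set. -/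
def cutSet (O : HLNet Color Var) (C : Set O.Trans) (ι : O.Assign) : Set (O.Place × Color) :=
  {bc | bc.1 ∈ O.cut C ∧ bc.2 = O.valOf ι bc.1}

/-- `Cuts(C) = {Cut(C,ι) : ι ∈ I(C)}`. -/
def cuts (O : HLNet Color Var) (C : Set O.Trans) : Set (Set (O.Place × Color)) :=
  {K | ∃ ι, O.IsInst C ι ∧ K = O.cutSet C ι}

/-- `Cuts(C)` as a set of markings of the occurrence net. -/
def cutMarks (O : HLNet Color Var) (C : Set O.Trans) : Set O.Marking :=
  {K | ∃ ι, O.IsInst C ι ∧ ∃ hfin : (O.cut C).Finite, K = O.cutMark hfin ι}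

/-- A homomorphism of high-level nets: maps places to places and transitions to
transitions, preserving guards and the presets and postsets of transitions. -/
structure Hom (O N : HLNet Color Var) where
  mapP : O.Place → N.Place
  mapT : O.Trans → N.Trans
  guard_iff : ∀ (e : O.Trans) (σ : Var → Color), O.guard e σ ↔ N.guard (mapT e) σ
  pre_eq : ∀ e : O.Trans, N.preFlow (mapT e) = (O.preFlow e).map fun bv => (mapP bv.1, bv.2)
  post_eq : ∀ e : O.Trans, N.postFlow (mapT e) = (O.postFlow e).map fun bv => (mapP bv.1, bv.2)

/-- The image of a marking under a homomorphism. -/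
def Hom.mapMarking {O N : HLNet Color Var} (φ : Hom O N) (M : O.Marking) : N.Marking :=
  M.map fun bc => (φ.mapP bc.1, bc.2)

/-- An initial homomorphism: it maps the initial markings onto the initial markings. -/
def Hom.Initial {O N : HLNet Color Var} (φ : Hom O N) : Prop :=
  φ.mapMarking '' O.init = N.init

/-- `Mark(C, ι)`: the marking of `N` represented by the cut of an instantiated
configuration. -/
def mark {O N : HLNet Color Var} (h : Hom O N) {C : Set O.Trans}
    (hfin : (O.cut C).Finite) (ι : O.Assign) : N.Marking :=
  hfin.toFinset.val.map fun b => (h.mapP b, O.valOf ι b)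

/-- `Marks(C) = {Mark(C,ι) : ι ∈ I(C)}`. -/
def marks {O N : HLNet Color Var} (h : Hom O N) (C : Set O.Trans) : Set N.Marking :=
  {M | ∃ ι, O.IsInst C ι ∧ ∃ hfin : (O.cut C).Finite, M = mark h hfin ι}

/-- `(O, h)` is a symbolic branching process of `N`: `O` is an occurrence net all of
whose event predicates are satisfiable, and `h` is an initial homomorphism that is
injective on events with the same preset. -/
def IsSBP {O N : HLNet Color Var} (h : Hom O N) : Prop :=
  O.IsOccNet ∧ h.Initial ∧ (∀ e : O.Trans, ∃ ι, O.pred e ι) ∧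
  ∀ e e' : O.Trans, O.preFlow e = O.preFlow e' → h.mapT e = h.mapT e' → e = e'

/-- `(O1, h1)` is a prefix of `(O2, h2)`: there is an injective initial homomorphism
`φ : O1 → O2` with `h2 ∘ φ = h1`. -/
def IsPrefix {O1 O2 N : HLNet Color Var} (h1 : Hom O1 N) (h2 : Hom O2 N) : Prop :=
  ∃ φ : Hom O1 O2, φ.Initial ∧ Function.Injective φ.mapP ∧ Function.Injective φ.mapT ∧
    (∀ b, h2.mapP (φ.mapP b) = h1.mapP b) ∧ ∀ e, h2.mapT (φ.mapT e) = h1.mapT e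

/-- `(O, h)` is the symbolic unfolding `Υ(N)` of `N`: the (unique up to isomorphism)
maximal symbolic branching process of `N`. -/
def IsUnfolding {O N : HLNet Color Var} (h : Hom O N) : Prop :=
  IsSBP h ∧ ∀ (O' : HLNet Color Var) (h' : Hom O' N), IsSBP h' → IsPrefix h' h

/-- The net `N` with its set of initial markings replaced by `I`. -/
def withInit (N : HLNet Color Var) (I : Set N.Marking) : HLNet Color Var :=
  { N with init := I }

/-- Restriction of a marking to a subset of the places. -/
def restrictMark (O : HLNet Color Var) (SP : Set O.Place) (M : O.Marking) :
    Multiset (↥SP × Color) :=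
  M.filterMap fun bc => if h : bc.1 ∈ SP then some (⟨bc.1, h⟩, bc.2) else none

/-- The subnet of `O` on the places `SP` and transitions `ST`, with initial markings `I`. -/
def restrict (O : HLNet Color Var) (SP : Set O.Place) (ST : Set O.Trans)
    (I : Set (Multiset (↥SP × Color))) : HLNet Color Var where
  Place := ↥SP
  Trans := ↥ST
  preFlow e := (O.preFlow e.1).filterMap fun bv =>
    if h : bv.1 ∈ SP then some (⟨bv.1, h⟩, bv.2) else none
  postFlow e := (O.postFlow e.1).filterMap fun bv =>
    if h : bv.1 ∈ SP then some (⟨bv.1, h⟩, bv.2) else none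
  guard e σ := O.guard e.1 σ
  init := I

/-- The predicate contributed by a node to a color conflict:
`pred(e)` for an event `e`, `pred(e(b))` for a condition `b`. -/
def nodePred (O : HLNet Color Var) (x : O.Node) (ι : O.Assign) : Prop :=
  match x with
  | Sum.inl b => O.condPred b ι
  | Sum.inr e => O.pred e ι

/-- The nodes of the future `↑C`: nodes not in `C ∪ →C`, not in structural conflict
with any event of `C`, and not in color conflict together with `C`. -/
def futureNode (O : HLNet Color Var) (C : Set O.Trans) (x : O.Node) : Prop :=
  (match x with
   | Sum.inl b => b ∉ O.preConds C
   | Sum.inr e => e ∉ C) ∧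
  (∀ e' ∈ C, ¬ O.SConflict (Sum.inr e') x) ∧
  ∃ ι, O.IsInst C ι ∧ O.nodePred x ι

def futurePlaces (O : HLNet Color Var) (C : Set O.Trans) : Set O.Place :=
  {b | O.futureNode C (Sum.inl b)}

def futureEvents (O : HLNet Color Var) (C : Set O.Trans) : Set O.Trans :=
  {e | O.futureNode C (Sum.inr e)}

/-- The underlying net of the future `↑C` of a configuration `C`, with the cuts of `C`
as initial cuts. -/
def future (O : HLNet Color Var) (C : Set O.Trans) : HLNet Color Var :=
  O.restrict (O.futurePlaces C) (O.futureEvents C)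
    (O.restrictMark (O.futurePlaces C) '' O.cutMarks C)

def futPVal (O : HLNet Color Var) (C : Set O.Trans) : (O.future C).Place → O.Place :=
  fun b => b.1

def futTVal (O : HLNet Color Var) (C : Set O.Trans) : (O.future C).Trans → O.Trans :=
  fun e => e.1

/-- The conditions of the occurrence net `O(C|D)`: `Cut(C) ∪ →D ∪ D→`. -/
def aroundPlaces (O : HLNet Color Var) (C D : Set O.Trans) : Set O.Place :=
  O.cut C ∪ O.preConds D ∪ O.postConds D

/-- The occurrence net `O(C|D)` "around `D` from `Cut(C)`", with initial cuts `Cuts(C)`. -/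
def around (O : HLNet Color Var) (C D : Set O.Trans) : HLNet Color Var :=
  O.restrict (O.aroundPlaces C D) D
    (O.restrictMark (O.aroundPlaces C D) '' O.cutMarks C)

def arPVal (O : HLNet Color Var) (C D : Set O.Trans) : (O.around C D).Place → O.Place :=
  fun b => b.1

def arTVal (O : HLNet Color Var) (C D : Set O.Trans) : (O.around C D).Trans → O.Trans :=
  fun e => e.1

/-- `D` is a suffix of `C`, i.e. `C ⊕ D` is defined: `C` and `D` are disjoint and
`C ∪ D` is a configuration. -/
def IsSuffix (O : HLNet Color Var) (C D : Set O.Trans) : Prop :=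
  Disjoint C D ∧ O.IsConfig (C ∪ D)

/-- `C⟦M⟧D`: some instantiation of `C ⊕ D`, restricted to the variables of `C ∪ {⊥}`,
yields the marking `M` for `C`. -/
def markRel {O N : HLNet Color Var} (h : Hom O N) (C : Set O.Trans) (M : N.Marking)
    (D : Set O.Trans) : Prop :=
  ∃ ι, O.IsInst (C ∪ D) ι ∧ ∃ hfin : (O.cut C).Finite, mark h hfin ι = M

/-- `φ` is a monomorphism `O(C1|D) → ↑C2` preserving the labeling and mapping
`Cut(C1)` onto `Cut(C2)`. -/
def IsCanonMono {O N : HLNet Color Var} (h : Hom O N) (C1 D C2 : Set O.Trans)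
    (φ : Hom (O.around C1 D) (O.future C2)) : Prop :=
  Function.Injective φ.mapP ∧ Function.Injective φ.mapT ∧
  (∀ b, h.mapP (O.futPVal C2 (φ.mapP b)) = h.mapP (O.arPVal C1 D b)) ∧
  (∀ e, h.mapT (O.futTVal C2 (φ.mapT e)) = h.mapT (O.arTVal C1 D e)) ∧
  (fun b => O.futPVal C2 (φ.mapP b)) '' {b | O.arPVal C1 D b ∈ O.cut C1} = O.cut C2

/-- `φ(D)`: the image of the events `D` of `O(C1|D)` under `φ`, as a set of events of `O`. -/
def monoImageD {O : HLNet Color Var} (C1 D C2 : Set O.Trans)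
    (φ : Hom (O.around C1 D) (O.future C2)) : Set O.Trans :=
  {e | ∃ d, O.futTVal C2 (φ.mapT d) = e}

/-- An adequate order on the finite configurations of a symbolic branching process
`(O, h)`: a well-founded strict partial order refining set inclusion and preserved
by finite extensions (via the canonical monomorphism between the futures). -/
def IsAdequate {O N : HLNet Color Var} (h : Hom O N)
    (r : Set O.Trans → Set O.Trans → Prop) : Prop :=
  (∀ C, O.FinCfg C → ¬ r C C) ∧
  (∀ C1 C2 C3, O.FinCfg C1 → O.FinCfg C2 → O.FinCfg C3 → r C1 C2 → r C2 C3 → r C1 C3) ∧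
  WellFounded (fun a b : {C : Set O.Trans // O.FinCfg C} => r a.1 b.1) ∧
  (∀ C1 C2, O.FinCfg C1 → O.FinCfg C2 → C1 ⊂ C2 → r C1 C2) ∧
  (∀ C1 C2 D M, O.FinCfg C1 → O.FinCfg C2 → O.IsSuffix C1 D → D.Finite →
    M ∈ marks h C1 → M ∈ marks h C2 → markRel h C1 M D →
    ∀ φ : Hom (O.around C1 D) (O.future C2), IsCanonMono h C1 D C2 φ →
      r C1 C2 → r (C1 ∪ D) (C2 ∪ monoImageD C1 D C2 φ))

/-- A cut-off event: every marking of its cone configuration is represented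
by the cone configuration of a `≺`-smaller event. -/
def IsCutoff {O N : HLNet Color Var} (h : Hom O N)
    (r : Set O.Trans → Set O.Trans → Prop) (e : O.Trans) : Prop :=
  ∀ M ∈ marks h (O.cone e), ∃ e', r (O.cone e') (O.cone e) ∧ M ∈ marks h (O.cone e')

/-- A cut-off* event: every marking of its cone configuration is represented
by some `≺`-smaller finite configuration. -/
def IsCutoffStar {O N : HLNet Color Var} (h : Hom O N)
    (r : Set O.Trans → Set O.Trans → Prop) (e : O.Trans) : Prop :=
  ∀ M ∈ marks h (O.cone e), ∃ C, O.FinCfg C ∧ r C (O.cone e) ∧ M ∈ marks h C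

/-- The events of the prefix `Fin`: events whose cone contains no cut-off event other
than possibly the event itself. -/
def finEvents {O N : HLNet Color Var} (h : Hom O N)
    (r : Set O.Trans → Set O.Trans → Prop) : Set O.Trans :=
  {e | ∀ e' ∈ O.cone e, e' ≠ e → ¬ IsCutoff h r e'}

/-- The conditions of the prefix `Fin`: the conditions of `B0` and those in the
postsets of the events of `Fin`. -/
def finConds {O N : HLNet Color Var} (h : Hom O N)
    (r : Set O.Trans → Set O.Trans → Prop) : Set O.Place :=
  O.B0 ∪ {b | ∃ e ∈ finEvents h r, ∃ v, (b, v) ∈ O.postFlow e}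

/-- The events of the prefix `Fin` for the cut-off* criterion. -/
def finEventsStar {O N : HLNet Color Var} (h : Hom O N)
    (r : Set O.Trans → Set O.Trans → Prop) : Set O.Trans :=
  {e | ∀ e' ∈ O.cone e, e' ≠ e → ¬ IsCutoffStar h r e'}

/-- The conditions of the prefix `Fin` for the cut-off* criterion. -/
def finCondsStar {O N : HLNet Color Var} (h : Hom O N)
    (r : Set O.Trans → Set O.Trans → Prop) : Set O.Place :=
  O.B0 ∪ {b | ∃ e ∈ finEventsStar h r, ∃ v, (b, v) ∈ O.postFlow e}

/-- Completeness of the sub-branching-process of `(O,h)` on the events `E'`: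
every reachable marking `M` of `N` is `Mark(C,ι)` for a configuration `C ⊆ E'` and
an instantiation `ι ∈ I(C)` such that moreover every transition/mode firable from `M`
is matched by an event of `E'` firable from `Cut(C,ι)`. -/
def CompleteSub {O N : HLNet Color Var} (h : Hom O N) (E' : Set O.Trans) : Prop :=
  ∀ M, N.Reach M → ∃ C, O.IsConfig C ∧ C ⊆ E' ∧ ∃ ι, O.IsInst C ι ∧
    ∃ hfin : (O.cut C).Finite, M = mark h hfin ι ∧
      ∀ (t : N.Trans) (σ : Var → Color), N.fires M t σ →
        ∃ e ∈ E', h.mapT e = t ∧ O.fires (O.cutMark hfin ι) e σ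

/-- Completeness of the branching process `(O, h)`. -/
def Complete {O N : HLNet Color Var} (h : Hom O N) : Prop := CompleteSub h Set.univ

/-- The class `Nf`: finite safe high-level Petri nets with decidable guards and
finitely many reachable markings. -/
def InNf (N : HLNet Color Var) : Prop :=
  N.NetFinite ∧ N.WellFormed ∧ N.Safe ∧ N.DecidableGuards ∧ {M | N.Reach M}.Finite

/-- The class `Nsc` of symbolically compact nets: finite safe high-level Petri nets
with decidable guards admitting a bound on the number of transition firings needed
to reach every reachable marking. -/
def InNsc (N : HLNet Color Var) : Prop :=
  N.NetFinite ∧ N.WellFormed ∧ N.Safe ∧ N.DecidableGuards ∧ ∃ n, N.BoundedReach n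

/-- The modes of a transition. -/
def Mode (N : HLNet Color Var) (t : N.Trans) : Type := {σ : Var → Color // N.guard t σ}

/-- The expansion `Exp(N)`: the P/T Petri net (a high-level net over the trivial sets
of colors and variables) with places `p.c` and transitions `t.σ`. -/
def expand (N : HLNet Color Var) : HLNet Unit Unit where
  Place := N.Place × Color
  Trans := (t : N.Trans) × N.Mode t
  preFlow tσ := (N.preMark tσ.1 tσ.2.1).map fun pc => (pc, ())
  postFlow tσ := (N.postMark tσ.1 tσ.2.1).map fun pc => (pc, ())
  guard _ _ := True
  init := (fun M : N.Marking => M.map fun pc => (pc, ())) '' N.init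

def expPlaceBase (N : HLNet Color Var) : N.expand.Place → N.Place := fun pc => pc.1
def expPlaceColor (N : HLNet Color Var) : N.expand.Place → Color := fun pc => pc.2
def expTransBase (N : HLNet Color Var) : N.expand.Trans → N.Trans := fun tσ => tσ.1
def expTransMode (N : HLNet Color Var) (tσ : N.expand.Trans) : Var → Color := tσ.2.1

/-- The constraint `constr(B')` on a co-set `B'` of conditions, evaluated on an
assignment `a` of colors to the labels `π(B')` (predb(b) for all `b ∈ B'`,
with all bound indexed variables existentially quantified at once). -/
def constrSat {O N : HLNet Color Var} (h : Hom O N) (B' : Set O.Place)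
    (a : N.Place → Color) : Prop :=
  ∃ ι : O.Assign, ∀ b ∈ B', O.condPred b ι ∧ a (h.mapP b) = O.valOf ι b

/-- `φ(E')`: the multiset of the transition labels of a finite set of events. -/
def labelMS {O N : HLNet Color Var} (h : Hom O N) (S : Set O.Trans) : Multiset N.Trans :=
  if hfin : S.Finite then hfin.toFinset.val.map h.mapT else 0

/-- Lexicographic comparison of the `≪`-sorted sequences of two multisets. -/
def msLex {α : Type} (lo : LinearOrder α) (s1 s2 : Multiset α) : Prop :=
  letI := lo
  List.Lex (· < ·) (s1.sort (· ≤ ·)) (s2.sort (· ≤ ·))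

/-- `Min(S)`: the causally minimal events of `S`. -/
def minOf (O : HLNet Color Var) (S : Set O.Trans) : Set O.Trans :=
  {e | e ∈ S ∧ ∀ e' ∈ S, ¬ O.evLT e' e}

/-- What remains of `C` after removing the first `n` blocks of its Foata normal form. -/
def foataResidual (O : HLNet Color Var) (C : Set O.Trans) : ℕ → Set O.Trans
  | 0 => C
  | n + 1 => foataResidual O C n \ O.minOf (foataResidual O C n)

/-- The `n`-th block of the Foata normal form of `C`. -/
def foataBlock (O : HLNet Color Var) (C : Set O.Trans) (n : ℕ) : Set O.Trans :=
  O.minOf (O.foataResidual C n)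

/-- `FC1 ≪ FC2`: comparison of Foata normal forms. -/
def foataLex {O N : HLNet Color Var} (h : Hom O N) (lo : LinearOrder N.Trans)
    (C1 C2 : Set O.Trans) : Prop :=
  ∃ i : ℕ, (∀ j < i, labelMS h (O.foataBlock C1 j) = labelMS h (O.foataBlock C2 j)) ∧
    msLex lo (labelMS h (O.foataBlock C1 i)) (labelMS h (O.foataBlock C2 i))

/-- McMillan's order `≺_M`: comparison by size. -/
def rM {O : HLNet Color Var} (C1 C2 : Set O.Trans) : Prop := C1.ncard < C2.ncard

/-- The order `≺_E`: by size, then lexicographically on sorted label sequences. -/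
def rE {O N : HLNet Color Var} (h : Hom O N) (lo : LinearOrder N.Trans)
    (C1 C2 : Set O.Trans) : Prop :=
  C1.ncard < C2.ncard ∨
    (C1.ncard = C2.ncard ∧ msLex lo (labelMS h C1) (labelMS h C2))

/-- The total order `≺_F`: by size, then lexicographically on sorted label sequences,
then by Foata normal forms. -/
def rF {O N : HLNet Color Var} (h : Hom O N) (lo : LinearOrder N.Trans)
    (C1 C2 : Set O.Trans) : Prop :=
  C1.ncard < C2.ncard ∨
    (C1.ncard = C2.ncard ∧ msLex lo (labelMS h C1) (labelMS h C2)) ∨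
    (labelMS h C1 = labelMS h C2 ∧ foataLex h lo C1 C2)

end HLNet

namespace HLNet

variable {Color Var : Type} {N O : HLNet Color Var}

lemma evLT_of_post_pre {e e' : O.Trans} {b : O.Place} {v v' : Var}
    (h1 : (b, v) ∈ O.postFlow e) (h2 : (b, v') ∈ O.preFlow e') : O.evLT e e' :=
  (Relation.TransGen.single (show O.arc (Sum.inr e) (Sum.inl b) from ⟨v, h1⟩)).tail
    (show O.arc (Sum.inl b) (Sum.inr e') from ⟨v', h2⟩)

lemma evLT.evLE {e e' : O.Trans} (hlt : O.evLT e e') : O.evLE e e' :=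
  Relation.TransGen.to_reflTransGen hlt

lemma evLE.eq_or_evLT {e e' : O.Trans} (hle : O.evLE e e') : e = e' ∨ O.evLT e e' := by
  rcases Relation.reflTransGen_iff_eq_or_transGen.1 hle with heq | hlt
  · exact Or.inl (Sum.inr_injective heq.symm)
  · exact Or.inr hlt

lemma IsOccNet.not_evLT_self (hO : O.IsOccNet) (e : O.Trans) : ¬ O.evLT e e :=
  hO.2.2.2.1 _

lemma IsOccNet.post_unique (hO : O.IsOccNet) {b : O.Place} {e e' : O.Trans} {v v' : Var}
    (h1 : (b, v) ∈ O.postFlow e) (h2 : (b, v') ∈ O.postFlow e') : e' = e ∧ v' = v := by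
  rcases hO.2.2.2.2.2 b with ⟨hb, -⟩ | ⟨⟨e0, v0, -, hu⟩, -⟩
  · exact absurd h1 (hb _ _)
  · obtain ⟨rfl, rfl⟩ := hu _ _ h1
    exact hu _ _ h2

lemma mem_B0_iff {b : O.Place} : b ∈ O.B0 ↔ ∀ e v, (b, v) ∉ O.postFlow e := by
  unfold B0 condPre
  simp

lemma IsOccNet.condPre_eq (hO : O.IsOccNet) {b : O.Place} {e : O.Trans} {v : Var}
    (hb : (b, v) ∈ O.postFlow e) : O.condPre b = some (e, v) := by
  have hex : ∃ ev : O.Trans × Var, (b, ev.2) ∈ O.postFlow ev.1 := ⟨(e, v), hb⟩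
  obtain ⟨h1, h2⟩ := hO.post_unique hb hex.choose_spec
  rw [condPre, dif_pos hex]
  exact congrArg some (Prod.ext h1 h2)

lemma IsOccNet.mem_B0_iff_mem_init (hO : O.IsOccNet) {K : O.Marking} (hK : K ∈ O.init)
    (b : O.Place) : b ∈ O.B0 ↔ b ∈ K.map Prod.fst := by
  rw [mem_B0_iff]
  rcases hO.2.2.2.2.2 b with ⟨hb, hc⟩ | ⟨⟨e, v, hev, -⟩, hc⟩
  · refine iff_of_true hb ?_
    obtain ⟨x, hx⟩ := Multiset.card_pos_iff_exists_mem.1 ((hc K hK).symm ▸ Nat.one_pos)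
    rw [Multiset.mem_filter] at hx
    exact Multiset.mem_map.2 ⟨x, hx⟩
  · refine iff_of_false (fun hb => hb _ _ hev) fun hb => ?_
    obtain ⟨x, hx⟩ := Multiset.mem_map.1 hb
    exact Multiset.eq_zero_iff_forall_notMem.1 (Multiset.card_eq_zero.1 (hc K hK)) x
      (Multiset.mem_filter.2 hx)

lemma nodup_map_fst_of_card_filter_le {α β : Type} (s : Multiset (α × β))
    (hs : ∀ a, (s.filter fun x => x.1 = a).card ≤ 1) : (s.map Prod.fst).Nodup := by
  rw [Multiset.nodup_iff_count_le_one]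
  intro a
  rw [Multiset.count_map]
  simpa only [eq_comm] using hs a

lemma IsOccNet.nodup_init (hO : O.IsOccNet) {K : O.Marking} (hK : K ∈ O.init) :
    (K.map Prod.fst).Nodup := by
  refine nodup_map_fst_of_card_filter_le K fun b => ?_
  rcases hO.2.2.2.2.2 b with ⟨-, hc⟩ | ⟨-, hc⟩
  · exact (hc K hK).le
  · exact (hc K hK).le.trans zero_le_one

lemma IsOccNet.finite_B0 (hO : O.IsOccNet) : O.B0.Finite := by
  obtain ⟨K, hK⟩ := hO.1.1
  refine (K.map Prod.fst).toFinset.finite_toSet.subset fun b hb => ?_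
  simpa using (hO.mem_B0_iff_mem_init hK b).1 hb

lemma finite_postConds {C : Set O.Trans} (hC : C.Finite) : (O.postConds C).Finite := by
  refine (hC.biUnion fun e _ => ((O.postFlow e).map Prod.fst).toFinset.finite_toSet).subset ?_
  rintro b ⟨e, he, v, hb⟩
  exact Set.mem_biUnion he (by simpa using ⟨v, hb⟩)

lemma IsOccNet.finite_cut (hO : O.IsOccNet) {C : Set O.Trans} (hC : C.Finite) :
    (O.cut C).Finite :=
  (hO.finite_B0.union (finite_postConds hC)).subset Set.sdiff_subset

/-- A strict causal predecessor precedes an event producing an input condition. -/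
lemma evLT_iff_exists_post_pre {e e' : O.Trans} : O.evLT e' e ↔
    ∃ d b v v', O.evLE e' d ∧ (b, v) ∈ O.postFlow d ∧ (b, v') ∈ O.preFlow e := by
  constructor
  · intro hlt
    obtain ⟨x, hx, hxe⟩ := Relation.TransGen.tail'_iff.1 hlt
    rcases x with b | t
    · obtain ⟨v', hv'⟩ := hxe
      rcases Relation.ReflTransGen.cases_tail hx with heq | ⟨y, hy, hyb⟩
      · cases heq
      · rcases y with c | d
        · exact hyb.elim
        · obtain ⟨v, hv⟩ := hyb
          exact ⟨d, b, v, v', hy, hv, hv'⟩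
    · exact hxe.elim
  · rintro ⟨d, b, v, v', hle, h1, h2⟩
    exact Relation.TransGen.trans_right hle (evLT_of_post_pre h1 h2)

lemma IsOccNet.finite_cone (hO : O.IsOccNet) (e : O.Trans) : (O.cone e).Finite := by
  have hwf : WellFounded O.evLT := InvImage.wf Sum.inr hO.2.2.2.2.1
  induction e using hwf.induction with
  | h e ih =>
  have hD : {d | ∃ b v v', (b, v) ∈ O.postFlow d ∧ (b, v') ∈ O.preFlow e}.Finite := by
    refine (((O.preFlow e).map Prod.fst).toFinset.finite_toSet.biUnion
      (t := fun b => {d | ∃ v, (b, v) ∈ O.postFlow d}) fun b _ =>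
        Set.Subsingleton.finite ?_).subset ?_
    · rintro d ⟨v, hd⟩ d' ⟨v', hd'⟩
      exact (hO.post_unique hd' hd).1
    · rintro d ⟨b, v, v', h1, h2⟩
      exact Set.mem_biUnion (x := b) (by simpa using ⟨v', h2⟩) ⟨v, h1⟩
  refine ((hD.biUnion (t := O.cone) ?_).insert e).subset fun e' he' => ?_
  · rintro d ⟨b, v, v', h1, h2⟩
    exact ih d (evLT_of_post_pre h1 h2)
  · rcases evLE.eq_or_evLT he' with rfl | hlt
    · exact Set.mem_insert _ _
    · obtain ⟨d, b, v, v', hle, h1, h2⟩ := evLT_iff_exists_post_pre.1 hlt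
      exact Or.inr (Set.mem_biUnion (x := d) ⟨b, v, v', h1, h2⟩ hle)

lemma pred.mono {e e' : O.Trans} {ι : O.Assign} (hp : O.pred e ι) (hle : O.evLE e' e) :
    O.pred e' ι :=
  ⟨hp.1, fun d hd => hp.2 d (Relation.ReflTransGen.trans hd hle)⟩

lemma IsSBP.finCfg_cone {h : Hom O N} (hB : IsSBP h) (e : O.Trans) : O.FinCfg (O.cone e) := by
  refine ⟨⟨fun d hd d' hd' => Relation.ReflTransGen.trans hd' hd, ?_, ?_⟩, hB.1.finite_cone e⟩
  · rintro d hd d' hd' ⟨b, t1, t2, hne, hb1, hb2, h1, h2⟩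
    exact hB.1.2.2.1 e ⟨b, t1, t2, hne, hb1, hb2, h1.trans hd, h2.trans hd'⟩
  · obtain ⟨ι, hι⟩ := hB.2.2.1 e
    exact ⟨ι, hι.1, fun d hd => hι.mono hd⟩

lemma IsOccNet.cone_ssubset (hO : O.IsOccNet) {e e' : O.Trans} (hlt : O.evLT e e') :
    O.cone e ⊂ O.cone e' := by
  refine ⟨fun d hd => Relation.ReflTransGen.trans hd hlt.evLE, fun hsub => ?_⟩
  exact hO.not_evLT_self e' (Relation.TransGen.trans_right (hsub Relation.ReflTransGen.refl) hlt)

lemma IsConfig.diff_maximal {C : Set O.Trans} (hC : O.IsConfig C) {e : O.Trans}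
    (hmax : ∀ e' ∈ C, ¬ O.evLT e e') : O.IsConfig (C \ {e}) := by
  obtain ⟨hcl, hcf, ι, hι⟩ := hC
  refine ⟨fun d hd d' hd' => ⟨hcl d hd.1 d' hd', ?_⟩,
    fun d hd d' hd' => hcf d hd.1 d' hd'.1, ι, hι.1, fun d hd => hι.2 d hd.1⟩
  rintro rfl
  rcases evLE.eq_or_evLT hd' with heq | hlt
  · exact hd.2 heq.symm
  · exact hmax d hd.1 hlt

lemma IsOccNet.preFlow_mem_cut_diff (hO : O.IsOccNet) {C : Set O.Trans} (hC : O.IsConfig C)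
    {e : O.Trans} (he : e ∈ C) {b : O.Place} {v : Var} (hb : (b, v) ∈ O.preFlow e) :
    b ∈ O.cut (C \ {e}) := by
  refine ⟨?_, ?_⟩
  · by_cases h0 : b ∈ O.B0
    · exact Or.inl h0
    · rw [mem_B0_iff] at h0
      push Not at h0
      obtain ⟨d, w, hd⟩ := h0
      have hlt : O.evLT d e := evLT_of_post_pre hd hb
      refine Or.inr ⟨d, ⟨hC.1 e he d hlt.evLE, ?_⟩, w, hd⟩
      rintro rfl
      exact hO.not_evLT_self _ hlt
  · rintro ⟨d, hd, w, hw⟩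
    exact hC.2.1 d hd.1 e he ⟨b, d, e, hd.2, ⟨w, hw⟩, ⟨v, hb⟩, .refl, .refl⟩

lemma mem_cut_iff_of_maximal {C : Set O.Trans} {e : O.Trans}
    (he : e ∈ C) (hmax : ∀ e' ∈ C, ¬ O.evLT e e') (b : O.Place) :
    b ∈ O.cut C ↔ (b ∈ O.cut (C \ {e}) ∧ b ∉ (O.preFlow e).map Prod.fst) ∨
      b ∈ (O.postFlow e).map Prod.fst := by
  have hmem : ∀ s : Multiset (O.Place × Var), b ∈ s.map Prod.fst ↔ ∃ v, (b, v) ∈ s := by simp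
  rw [hmem, hmem]
  constructor
  · rintro ⟨h1, h2⟩
    by_cases hp : ∃ v, (b, v) ∈ O.postFlow e
    · exact Or.inr hp
    · refine Or.inl ⟨⟨h1.imp_right ?_, fun ⟨d, hd, w⟩ => h2 ⟨d, hd.1, w⟩⟩,
        fun hw => h2 ⟨e, he, hw⟩⟩
      rintro ⟨d, hd, w⟩
      exact ⟨d, ⟨hd, fun hde => hp (Set.mem_singleton_iff.1 hde ▸ w)⟩, w⟩
  · rintro (⟨⟨h1, h2⟩, h3⟩ | ⟨v, hv⟩)
    · refine ⟨h1.imp_right fun ⟨d, hd, w⟩ => ⟨d, hd.1, w⟩, ?_⟩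
      rintro ⟨d, hd, w⟩
      by_cases hde : d = e
      · exact h3 (hde ▸ w)
      · exact h2 ⟨d, ⟨hd, hde⟩, w⟩
    · refine ⟨Or.inr ⟨e, he, v, hv⟩, ?_⟩
      rintro ⟨d, hd, w, hw⟩
      exact hmax d hd (evLT_of_post_pre hv hw)

lemma IsOccNet.firesTo_cutMark (hO : O.IsOccNet) {C : Set O.Trans} (hC : O.IsConfig C)
    {ι : O.Assign} (hι : O.IsInst C ι) {e : O.Trans} (he : e ∈ C)
    (hmax : ∀ e' ∈ C, ¬ O.evLT e e') (hfin : (O.cut C).Finite)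
    (hfin' : (O.cut (C \ {e})).Finite) :
    O.firesTo (O.cutMark hfin' ι) e (fun v => ι (Sum.inl (e, v))) (O.cutMark hfin ι) := by
  have hloc : O.locPred e ι := (hι.2 e he).2 e .refl
  have hpre : O.preMark e (fun v => ι (Sum.inl (e, v))) =
      ((O.preFlow e).map Prod.fst).map fun b => (b, O.valOf ι b) := by
    rw [preMark, Multiset.map_map]
    exact Multiset.map_congr rfl fun bv hbv => Prod.ext rfl (hloc.2 bv hbv)
  have hpost : O.postMark e (fun v => ι (Sum.inl (e, v))) =
      ((O.postFlow e).map Prod.fst).map fun b => (b, O.valOf ι b) := by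
    rw [postMark, Multiset.map_map]
    refine Multiset.map_congr rfl fun bv hbv => Prod.ext rfl ?_
    simp [valOf, hO.condPre_eq (b := bv.1) (v := bv.2) hbv]
  have hnpre := nodup_map_fst_of_card_filter_le _ (hO.2.1.1 e)
  have hnpost := nodup_map_fst_of_card_filter_le _ (hO.2.1.2 e)
  have hle : (O.preFlow e).map Prod.fst ≤ hfin'.toFinset.val := by
    refine (Multiset.le_iff_subset hnpre).2 fun b hb => ?_
    obtain ⟨⟨b, v⟩, hbv, rfl⟩ := Multiset.mem_map.1 hb
    simpa using hO.preFlow_mem_cut_diff hC he hbv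
  obtain ⟨R, hR⟩ := Multiset.le_iff_exists_add.1 hle
  have hnR : ((O.preFlow e).map Prod.fst + R).Nodup := hR ▸ hfin'.toFinset.nodup
  rw [Multiset.nodup_add] at hnR
  have hmemR : ∀ b, b ∈ R ↔ b ∈ O.cut (C \ {e}) ∧ b ∉ (O.preFlow e).map Prod.fst := by
    intro b
    have hb : b ∈ O.cut (C \ {e}) ↔ b ∈ (O.preFlow e).map Prod.fst ∨ b ∈ R := by
      rw [← Multiset.mem_add, ← hR, Finset.mem_val, Set.Finite.mem_toFinset]
    have hd : b ∈ (O.preFlow e).map Prod.fst → b ∉ R := fun h1 =>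
      Multiset.disjoint_left.1 hnR.2.2 h1
    tauto
  have hnew : hfin.toFinset.val = R + (O.postFlow e).map Prod.fst := by
    refine (Multiset.Nodup.ext hfin.toFinset.nodup
      (Multiset.nodup_add.2 ⟨hnR.2.1, hnpost, Multiset.disjoint_left.2 ?_⟩)).2 fun b => ?_
    · intro b hb hb'
      obtain ⟨⟨b, v⟩, hbv, rfl⟩ := Multiset.mem_map.1 hb'
      rcases ((hmemR _).1 hb).1.1 with h0 | ⟨d, hd, w, hw⟩
      · exact mem_B0_iff.1 h0 _ _ hbv
      · exact hd.2 (hO.post_unique hbv hw).1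
    · rw [Multiset.mem_add, hmemR, ← mem_cut_iff_of_maximal he hmax, Finset.mem_val,
        Set.Finite.mem_toFinset]
  refine ⟨⟨hloc.1, ?_⟩, ?_⟩
  · rw [hpre, cutMark]
    exact Multiset.map_le_map hle
  · rw [hpre, hpost, cutMark, cutMark, hR, hnew, Multiset.map_add, Multiset.map_add,
      add_tsub_cancel_left]

lemma IsOccNet.cutMark_empty_mem_init (hO : O.IsOccNet) {ι : O.Assign} (hι : O.predBot ι)
    (hfin : (O.cut ∅).Finite) : O.cutMark hfin ι ∈ O.init := by
  obtain ⟨K, hK, hval⟩ := hι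
  have hcut : hfin.toFinset.val = K.map Prod.fst := by
    refine (Multiset.Nodup.ext hfin.toFinset.nodup (hO.nodup_init hK)).2 fun b => ?_
    rw [← hO.mem_B0_iff_mem_init hK]
    simp [cut, postConds, preConds]
  have heq : O.cutMark hfin ι = K := by
    rw [cutMark, hcut, Multiset.map_map]
    conv_rhs => rw [← Multiset.map_id K]
    refine Multiset.map_congr rfl fun bc hbc => Prod.ext rfl ?_
    have h0 : O.condPre bc.1 = none :=
      (hO.mem_B0_iff_mem_init hK bc.1).2 (Multiset.mem_map_of_mem _ hbc)
    simpa [valOf, h0] using hval bc.1 bc.2 hbc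
  exact heq ▸ hK

lemma IsOccNet.reach_cutMark (hO : O.IsOccNet) {C : Set O.Trans} (hCfin : C.Finite)
    (hC : O.IsConfig C) {ι : O.Assign} (hι : O.IsInst C ι) (hfin : (O.cut C).Finite) :
    O.Reach (O.cutMark hfin ι) := by
  induction hn : C.ncard generalizing C with
  | zero =>
    obtain rfl := (Set.ncard_eq_zero hCfin).1 hn
    exact .init (hO.cutMark_empty_mem_init hι.1 hfin)
  | succ n ih =>
    have hne : C.Nonempty := (Set.ncard_pos hCfin).1 (by omega)
    obtain ⟨e, he, hm⟩ := Set.exists_max_image C (fun e => (O.cone e).ncard) hCfin hne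
    have hmax : ∀ e' ∈ C, ¬ O.evLT e e' := fun e' he' hlt =>
      (hm e' he').not_gt (Set.ncard_lt_ncard (hO.cone_ssubset hlt) (hO.finite_cone e'))
    have hfin' : (O.cut (C \ {e})).Finite := hO.finite_cut hCfin.sdiff
    refine .step (ih hCfin.sdiff (hC.diff_maximal hmax)
      ⟨hι.1, fun d hd => hι.2 d hd.1⟩ hfin' ?_) (hO.firesTo_cutMark hC hι he hmax hfin hfin')
    rw [Set.ncard_sdiff_singleton_of_mem he, hn, Nat.add_sub_cancel]

lemma Hom.reach_mapMarking (h : Hom O N) (hI : h.Initial) {M : O.Marking}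
    (hM : O.Reach M) : N.Reach (h.mapMarking M) := by
  induction hM with
  | init hM => exact .init (hI ▸ Set.mem_image_of_mem _ hM)
  | @step M t σ M' _ hf ih =>
    obtain ⟨⟨hg, hle⟩, rfl⟩ := hf
    have hpre : N.preMark (h.mapT t) σ = h.mapMarking (O.preMark t σ) := by
      simp [preMark, mapMarking, h.pre_eq, Multiset.map_map]
    have hpost : N.postMark (h.mapT t) σ = h.mapMarking (O.postMark t σ) := by
      simp [postMark, mapMarking, h.post_eq, Multiset.map_map]
    obtain ⟨R, rfl⟩ := Multiset.le_iff_exists_add.1 hle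
    refine .step (t := h.mapT t) (σ := σ) ih ⟨⟨(h.guard_iff t σ).1 hg, ?_⟩, ?_⟩
    · rw [hpre]
      exact Multiset.map_le_map hle
    · rw [hpre, hpost, add_tsub_cancel_left]
      simp only [mapMarking, Multiset.map_add, add_tsub_cancel_left]

lemma IsSBP.reach_of_mem_marks {h : Hom O N} (hB : IsSBP h) {C : Set O.Trans}
    (hC : O.FinCfg C) {M : N.Marking} (hM : M ∈ marks h C) : N.Reach M := by
  obtain ⟨ι, hι, hfin, rfl⟩ := hM
  have hreach := h.reach_mapMarking hB.2.1 (hB.1.reach_cutMark hC.2 hC.1 hι hfin)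
  rwa [Hom.mapMarking, cutMark, Multiset.map_map] at hreach

/-- The non-cut-off events of a causal chain represent pairwise distinct reachable markings. -/
lemma IsSBP.chain_length_le {h : Hom O N} (hB : IsSBP h) (hR : {M | N.Reach M}.Finite)
    {r : Set O.Trans → Set O.Trans → Prop} (hr : IsAdequate h r) {k : ℕ}
    (f : Fin k → O.Trans) (hf : ∀ i j, i < j → O.evLT (f i) (f j))
    (hcut : ∀ i, ¬ IsCutoff h r (f i)) : k ≤ {M | N.Reach M}.ncard := by
  unfold IsCutoff at hcut
  push Not at hcut
  choose m hm hnew using hcut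
  have hlt : ∀ i j, i < j → m i ≠ m j := fun i j hij heq =>
    hnew j (f i) (hr.2.2.2.1 _ _ (hB.finCfg_cone _) (hB.finCfg_cone _)
      (hB.1.cone_ssubset (hf i j hij))) (heq ▸ hm i)
  have hinj : Function.Injective m := by
    intro i j hij
    by_contra hne
    rcases lt_or_gt_of_ne hne with hl | hl
    · exact hlt i j hl hij
    · exact hlt j i hl hij.symm
  calc k = (Set.range m).ncard := by
        rw [← Set.image_univ, Set.ncard_image_of_injective _ hinj, Set.ncard_univ, Nat.card_fin]
    _ ≤ _ := Set.ncard_le_ncard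
        (Set.range_subset_iff.2 fun i => hB.reach_of_mem_marks (hB.finCfg_cone _) (hm i)) hR

lemma IsSBP.length_le_of_mem_finEvents {h : Hom O N} (hB : IsSBP h)
    (hR : {M | N.Reach M}.Finite) {r : Set O.Trans → Set O.Trans → Prop}
    (hr : IsAdequate h r) {e : O.Trans} (he : e ∈ finEvents h r) {k : ℕ}
    (f : Fin (k + 1) → O.Trans) (hf : ∀ i j, i < j → O.evLT (f i) (f j))
    (hlast : f (Fin.last k) = e) : k ≤ {M | N.Reach M}.ncard := by
  refine hB.chain_length_le hR hr (fun i => f i.castSucc)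
    (fun i j hij => hf _ _ (Fin.castSucc_lt_castSucc_iff.2 hij)) fun i => ?_
  have hlt : O.evLT (f i.castSucc) e := hlast ▸ hf _ _ (Fin.castSucc_lt_last i)
  exact he _ hlt.evLE fun heq => hB.1.not_evLT_self e (heq ▸ hlt)

lemma finite_setOf_multiset_card {α : Type} {s : Set α} (hs : s.Finite) (n : ℕ) :
    {m : Multiset α | (∀ a ∈ m, a ∈ s) ∧ m.card = n}.Finite := by
  refine (Multiset.finite_toSet (Multiset.powerset (n • hs.toFinset.val))).subset ?_
  rintro m ⟨hm, rfl⟩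
  refine Multiset.mem_powerset.2 (Multiset.le_iff_count.2 fun a => ?_)
  by_cases ha : a ∈ m
  · have h1 : Multiset.count a hs.toFinset.val = 1 :=
      Multiset.count_eq_one_of_mem hs.toFinset.nodup (by simpa using hm a ha)
    rw [Multiset.count_nsmul, h1, mul_one]
    exact Multiset.count_le_card a m
  · rw [Multiset.count_eq_zero_of_notMem ha]
    exact Nat.zero_le _

lemma IsSBP.finite_events_of_preset_subset {h : Hom O N} (hB : IsSBP h) [Finite N.Trans]
    {B : Set O.Place} (hfinB : B.Finite) :
    {e : O.Trans | ∀ bv ∈ O.preFlow e, bv.1 ∈ B}.Finite := by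
  let V (t : N.Trans) : Set Var := {v | v ∈ (N.preFlow t).map Prod.snd}
  have hV : ∀ t, (V t).Finite := fun t => Multiset.finite_toSet _
  have hS : (⋃ t : N.Trans, {t} ×ˢ {m : Multiset (O.Place × Var) |
      (∀ bv ∈ m, bv ∈ B ×ˢ V t) ∧ m.card = (N.preFlow t).card}).Finite :=
    Set.finite_iUnion fun t => (Set.finite_singleton t).prod
      (finite_setOf_multiset_card (hfinB.prod (hV t)) _)
  refine Set.Finite.of_finite_image (f := fun e => (h.mapT e, O.preFlow e)) (hS.subset ?_) ?_
  · rintro _ ⟨e, he, rfl⟩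
    refine Set.mem_iUnion.2 ⟨h.mapT e, rfl, fun bv hbv => ⟨he bv hbv, ?_⟩, ?_⟩
    · simp only [V, h.pre_eq, Multiset.map_map, Set.mem_ofPred_eq]
      exact Multiset.mem_map.2 ⟨bv, hbv, rfl⟩
    · simp [h.pre_eq]
  · intro e _ e' _ heq
    exact hB.2.2.2 e e' (congrArg Prod.snd heq) (congrArg Prod.fst heq)

/-- The events of depth at most `n`. -/
def shallowEvents (O : HLNet Color Var) : ℕ → Set O.Trans
  | 0 => ∅
  | n + 1 => {e | ∀ bv ∈ O.preFlow e, bv.1 ∈ O.B0 ∪ O.postConds (O.shallowEvents n)}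

lemma IsSBP.finite_shallowEvents {h : Hom O N} (hB : IsSBP h) [Finite N.Trans] (n : ℕ) :
    (O.shallowEvents n).Finite := by
  induction n with
  | zero => exact Set.finite_empty
  | succ n ih =>
    exact hB.finite_events_of_preset_subset (hB.1.finite_B0.union (finite_postConds ih))

lemma exists_chain_of_notMem_shallowEvents (n : ℕ) (e : O.Trans)
    (he : e ∉ O.shallowEvents n) : ∃ f : Fin (n + 1) → O.Trans,
      (∀ i j, i < j → O.evLT (f i) (f j)) ∧ f (Fin.last n) = e := by
  induction n generalizing e with
  | zero => exact ⟨fun _ => e, fun i j hij => absurd hij (by omega), rfl⟩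
  | succ n ih =>
    simp only [shallowEvents, Set.mem_ofPred_eq] at he
    push Not at he
    obtain ⟨⟨b, v⟩, hbv, hb⟩ := he
    rw [Set.mem_union, not_or, mem_B0_iff] at hb
    push Not at hb
    obtain ⟨⟨d, w, hd⟩, hb⟩ := hb
    obtain ⟨f, hf, hlast⟩ := ih d fun hdn => hb ⟨d, hdn, w, hd⟩
    have hde : O.evLT d e := evLT_of_post_pre hd hbv
    have hfe : ∀ i, O.evLT (f i) e := fun i => by
      rcases (Fin.le_last i).eq_or_lt with rfl | hlt
      · exact hlast ▸ hde
      · exact Relation.TransGen.trans (hf _ _ hlt) (hlast ▸ hde)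
    refine ⟨Fin.snoc (α := fun _ => O.Trans) f e, fun i j hij => ?_, Fin.snoc_last _ _⟩
    induction j using Fin.lastCases with
    | last =>
      induction i using Fin.lastCases with
      | last => exact absurd hij (lt_irrefl _)
      | cast i => simpa using hfe i
    | cast j =>
      induction i using Fin.lastCases with
      | last => exact absurd hij (Fin.castSucc_lt_last j).not_gt
      | cast i => simpa using hf i j (Fin.castSucc_lt_castSucc_iff.1 hij)

end HLNet

/-- Let `N` be a high-level Petri net in the class `Nf`, let `≺` be an
adequate order on the finite configurations of its symbolic unfolding `Υ = (O, h)`,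
and let `Fin` be the prefix of `Υ` consisting of all events `e` such that the cone `[e]`
contains no cut-off event of `Υ` other than possibly `e` itself, together with all
conditions in `B0` and in the postsets of these events. Then `Fin` is finite;
in particular, every event `e` of `Fin` satisfies `depth(e) ≤ |R(N)| + 1`, where
`depth(e)` is the length of the longest chain of events `e1 < e2 < … < e` ending in `e`. -/
theorem fin_prefix_is_finite {Color Var : Type} (N O : HLNet Color Var)
    (h : HLNet.Hom O N) (hNf : N.InNf) (hU : HLNet.IsUnfolding h)
    (r : Set O.Trans → Set O.Trans → Prop) (hr : HLNet.IsAdequate h r) :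
    (HLNet.finEvents h r).Finite ∧ (HLNet.finConds h r).Finite ∧
      ∀ e ∈ HLNet.finEvents h r, ∀ (k : ℕ) (f : Fin (k + 1) → O.Trans),
        (∀ i j, i < j → O.evLT (f i) (f j)) → f (Fin.last k) = e →
          k + 1 ≤ {M | N.Reach M}.ncard + 1 := by
  have hB := hU.1
  have hR := hNf.2.2.2.2
  have : Finite N.Trans := hNf.1.2
  have hfin : (HLNet.finEvents h r).Finite := by
    refine (hB.finite_shallowEvents ({M | N.Reach M}.ncard + 1)).subset fun e he => ?_
    by_contra hne
    obtain ⟨f, hf, hlast⟩ := HLNet.exists_chain_of_notMem_shallowEvents _ e hne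
    exact absurd (hB.length_le_of_mem_finEvents hR hr he f hf hlast) (by omega)
  exact ⟨hfin, hB.1.finite_B0.union (HLNet.finite_postConds hfin), fun e he k f hf hlast =>
    Nat.succ_le_succ (hB.length_le_of_mem_finEvents hR hr he f hf hlast)⟩
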